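/- Let M be a unitary magma. For every n ≥ 1, the set of noncrossing M-cliques of arity n is in bijection with the set of M-Schröder trees having n leaves. -/

import Mathlib

/-! Noncrossing `M`-cliques for a unitary magma `M` (modeled as `MulOneClass`),
and the algebraic equation satisfied by their generating series. -/

/-- An arc of a polygon with `n+1` vertices (0-indexed vertices `0,…,n`),
given by a pair of vertices `x < y`.  For an `M`-clique of arity `n`,
this corresponds to the arcs `(x,y)` with `1 ≤ x < y ≤ n+1` (1-indexed). -/
def Arc (n : ℕ) : Type := {a : Fin (n + 1) × Fin (n + 1) // a.1 < a.2}

/-- An `M`-clique of arity `n`: a labeling of all arcs by elements of `M`. -/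
def CliqueLab (M : Type) (n : ℕ) : Type := Arc n → M

namespace Arc

/-- The base: the arc `(0, n)` (0-indexed), i.e. `(1, n+1)` (1-indexed). -/
def IsBase {n : ℕ} (a : Arc n) : Prop := (a.val.1 : ℕ) = 0 ∧ (a.val.2 : ℕ) = n

/-- The edges: the arcs `(i, i+1)`. -/
def IsEdge {n : ℕ} (a : Arc n) : Prop := (a.val.2 : ℕ) = (a.val.1 : ℕ) + 1

/-- A diagonal: an arc which is neither the base nor an edge. -/
def IsDiagonal {n : ℕ} (a : Arc n) : Prop := ¬ a.IsBase ∧ ¬ a.IsEdge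

/-- Two arcs cross if `x < x' < y < y'` or `x' < x < y' < y`. -/
def Cross {n : ℕ} (a b : Arc n) : Prop :=
  ((a.val.1 : ℕ) < (b.val.1 : ℕ) ∧ (b.val.1 : ℕ) < (a.val.2 : ℕ) ∧
      (a.val.2 : ℕ) < (b.val.2 : ℕ)) ∨
  ((b.val.1 : ℕ) < (a.val.1 : ℕ) ∧ (a.val.1 : ℕ) < (b.val.2 : ℕ) ∧
      (b.val.2 : ℕ) < (a.val.2 : ℕ))

end Arc

/-- An `M`-clique is noncrossing if no two of its solid diagonals cross. -/
def Noncrossing {M : Type} [One M] {n : ℕ} (p : CliqueLab M n) : Prop :=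
  ∀ a b : Arc n, a.IsDiagonal → b.IsDiagonal → p a ≠ 1 → p b ≠ 1 → ¬ a.Cross b

/-- The type of noncrossing `M`-cliques of arity `n`.  By convention there is exactly
one noncrossing `M`-clique of arity `1`: the unit clique, whose only arc is labeled
by the unit of `M`. -/
def NCClique (M : Type) [One M] (n : ℕ) : Type :=
  {p : CliqueLab M n // Noncrossing p ∧ (n = 1 → ∀ a, p a = 1)}

/-- The number of noncrossing `M`-cliques of arity `n`. -/
noncomputable def ncCount (M : Type) [One M] (n : ℕ) : ℕ := Nat.card (NCClique M n)

/-- Plane rooted trees whose edges towards children carry labels in `M`: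
a node carries the list of its (edge label, child subtree) pairs. -/
inductive STree (M : Type) : Type
  | leaf : STree M
  | node : List (M × STree M) → STree M

namespace STree

/-- A tree is internal when it is a node. -/
def IsInternal {M : Type} : STree M → Prop
  | leaf => False
  | node _ => True

mutual
  /-- Number of leaves of a tree. -/
  def leaves {M : Type} : STree M → ℕ
    | .leaf => 1
    | .node cs => leavesList cs
  /-- Total number of leaves of a list of labeled subtrees. -/
  def leavesList {M : Type} : List (M × STree M) → ℕ
    | [] => 0
    | c :: cs => leaves c.2 + leavesList cs
end

/-- Validity for (sub)trees of an `M`-Schröder tree: every internal node has at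
least two children, and every edge towards an internal child carries a label
different from the unit of `M`.  (Edges towards leaves may carry any label.) -/
inductive Valid {M : Type} [One M] : STree M → Prop
  | leaf : Valid leaf
  | node (cs : List (M × STree M)) (hlen : 2 ≤ cs.length)
      (hvalid : ∀ c ∈ cs, Valid c.2)
      (hlab : ∀ c ∈ cs, IsInternal c.2 → c.1 ≠ 1) :
      Valid (node cs)

end STree

/-- An `M`-Schröder tree: either the tree consisting of a single leaf (the unique
`M`-Schröder tree with one leaf), or a valid tree with internal root together with
the label in `M` of the outgoing edge above the root. -/
inductive MSchroder (M : Type) [One M] : Type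
  | single : MSchroder M
  | rooted (rootLabel : M) (cs : List (M × STree M))
      (hvalid : STree.Valid (STree.node cs)) : MSchroder M

/-- Number of leaves of an `M`-Schröder tree. -/
def MSchroder.leaves {M : Type} [One M] : MSchroder M → ℕ
  | single => 1
  | rooted _ cs _ => STree.leaves (STree.node cs)

namespace STree

variable {M : Type}

theorem leavesList_cons (c : M × STree M) (cs : List (M × STree M)) :
    leavesList (c :: cs) = leaves c.2 + leavesList cs := by
  rw [leavesList]

theorem length_le_leavesList {cs : List (M × STree M)} (h : ∀ c ∈ cs, 1 ≤ leaves c.2) :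
    cs.length ≤ leavesList cs := by
  induction cs with
  | nil => simp
  | cons c cs ih =>
    have h₁ := h c (by simp)
    have h₂ := ih fun d hd => h d (by simp [hd])
    rw [leavesList_cons, List.length_cons]
    omega

variable [One M]

mutual
  /-- The label of the arc `(x, y)` in the clique encoded by a tree whose leaves are the edges
  `(a, a + 1), (a + 1, a + 2), …`, the arc of the root itself being left unlabeled. -/
  def inner : STree M → ℕ → ℕ → ℕ → M
    | .leaf => fun _ _ _ => 1
    | .node cs => fun a x y => innerList cs a x y
  /-- The label of the arc `(x, y)` in the cliques encoded by a list of labeled trees, placed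
  side by side starting from the vertex `a`. -/
  def innerList : List (M × STree M) → ℕ → ℕ → ℕ → M
    | [] => fun _ _ _ => 1
    | c :: cs => fun a x y =>
        if y ≤ a + leaves c.2 then
          if x = a ∧ y = a + leaves c.2 then c.1 else inner c.2 a x y
        else innerList cs (a + leaves c.2) x y
end

theorem innerList_cons (c : M × STree M) (cs : List (M × STree M)) (a x y : ℕ) :
    innerList (c :: cs) a x y =
      if y ≤ a + leaves c.2 then
        if x = a ∧ y = a + leaves c.2 then c.1 else inner c.2 a x y
      else innerList cs (a + leaves c.2) x y := by
  rw [innerList]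

theorem Valid.one_le_leaves {t : STree M} (ht : Valid t) : 1 ≤ leaves t := by
  induction ht with
  | leaf => simp [leaves]
  | node cs hlen _ _ ih =>
    rw [leaves]
    have := length_le_leavesList ih
    omega

theorem Valid.two_le_leavesList {cs : List (M × STree M)} (h : Valid (.node cs)) :
    2 ≤ leavesList cs := by
  cases h with
  | node _ hlen hvalid _ =>
    have := length_le_leavesList fun c hc => (hvalid c hc).one_le_leaves
    omega

theorem Valid.isInternal_iff {t : STree M} (ht : Valid t) : IsInternal t ↔ 2 ≤ leaves t := by
  cases t with
  | leaf => simp [IsInternal, leaves]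
  | node cs => simpa [IsInternal, leaves] using ht.two_le_leavesList

/-- The solid arcs of a list of trees lie within its span. -/
theorem innerList_support {cs : List (M × STree M)} (hpos : ∀ c ∈ cs, 1 ≤ leaves c.2)
    (ih : ∀ c ∈ cs, ∀ a x y, inner c.2 a x y ≠ 1 →
      a ≤ x ∧ x < y ∧ y ≤ a + leaves c.2 ∧ ¬(x = a ∧ y = a + leaves c.2))
    (a x y : ℕ) (h : innerList cs a x y ≠ 1) :
    a ≤ x ∧ x < y ∧ y ≤ a + leavesList cs := by
  induction cs generalizing a with
  | nil => simp [innerList] at h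
  | cons c cs ihl =>
    have hc := hpos c (by simp)
    have ihc := ih c (by simp) a x y
    have ihcs := ihl (fun d hd => hpos d (by simp [hd])) (fun d hd => ih d (by simp [hd]))
      (a + leaves c.2)
    rw [innerList_cons] at h
    rw [leavesList_cons]
    split_ifs at h with h₁ h₂
    · omega
    · have := ihc h
      omega
    · have := ihcs h
      omega

theorem Valid.inner_support {t : STree M} (ht : Valid t) (a x y : ℕ) (h : inner t a x y ≠ 1) :
    a ≤ x ∧ x < y ∧ y ≤ a + leaves t ∧ ¬(x = a ∧ y = a + leaves t) := by
  induction ht generalizing a x y with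
  | leaf => simp [inner] at h
  | node cs hlen hvalid hlab ih =>
    have hpos : ∀ c ∈ cs, 1 ≤ leaves c.2 := fun c hc => (hvalid c hc).one_le_leaves
    simp only [inner] at h
    rw [leaves]
    obtain ⟨h₁, h₂, h₃⟩ := innerList_support hpos ih a x y h
    refine ⟨h₁, h₂, h₃, ?_⟩
    rintro ⟨rfl, rfl⟩
    match cs with
    | [] => simp at hlen
    | [c] => simp at hlen
    | c :: d :: cs =>
      have hc := hpos c (by simp)
      have hd := hpos d (by simp)
      rw [innerList_cons, leavesList_cons, leavesList_cons, if_neg (by omega)] at h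
      have := innerList_support (fun e he => hpos e (List.mem_cons_of_mem _ he))
        (fun e he => ih e (List.mem_cons_of_mem _ he)) _ _ _ h
      omega

theorem innerList_support_of_valid {cs : List (M × STree M)} (hv : ∀ c ∈ cs, Valid c.2)
    (a x y : ℕ) (h : innerList cs a x y ≠ 1) : a ≤ x ∧ x < y ∧ y ≤ a + leavesList cs :=
  innerList_support (fun c hc => (hv c hc).one_le_leaves)
    (fun c hc => (hv c hc).inner_support) a x y h

theorem innerList_noncrossing {cs : List (M × STree M)} (hv : ∀ c ∈ cs, Valid c.2)
    (ih : ∀ c ∈ cs, ∀ a x x' y y', x < x' → x' < y → y < y' →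
      inner c.2 a x y ≠ 1 → inner c.2 a x' y' = 1)
    (a x x' y y' : ℕ) (h₁ : x < x') (h₂ : x' < y) (h₃ : y < y')
    (h : innerList cs a x y ≠ 1) : innerList cs a x' y' = 1 := by
  induction cs generalizing a with
  | nil => simp [innerList]
  | cons c cs ihl =>
    have hvcs : ∀ d ∈ cs, Valid d.2 := fun d hd => hv d (by simp [hd])
    have ihc := ih c (by simp) a x x' y y' h₁ h₂ h₃
    have hsc := (hv c (by simp)).inner_support a x y
    have ihcs := ihl hvcs (fun d hd => ih d (by simp [hd])) (a + leaves c.2)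
    have hscs := innerList_support_of_valid hvcs (a + leaves c.2) x' y'
    by_contra h'
    rw [innerList_cons] at h h'
    split_ifs at h h' <;> grind

theorem Valid.inner_noncrossing {t : STree M} (ht : Valid t) (a x x' y y' : ℕ)
    (h₁ : x < x') (h₂ : x' < y) (h₃ : y < y') (h : inner t a x y ≠ 1) :
    inner t a x' y' = 1 := by
  induction ht generalizing a x x' y y' with
  | leaf => simp [inner]
  | node cs hlen hvalid hlab ih =>
    rw [inner] at h ⊢
    exact innerList_noncrossing hvalid ih a x x' y y' h₁ h₂ h₃ h

/-- If the arcs of two lists of trees carry the same labels, then the first tree of one list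
has at least as many leaves as the first tree of the other. -/
theorem leaves_le_of_innerList_eq {c c' : M × STree M} {cs cs' : List (M × STree M)} {a : ℕ}
    (hv : ∀ e ∈ c :: cs, Valid e.2) (hc' : Valid c'.2) (hlab : IsInternal c'.2 → c'.1 ≠ 1)
    (h : ∀ x y, innerList (c :: cs) a x y = innerList (c' :: cs') a x y) :
    leaves c'.2 ≤ leaves c.2 := by
  by_contra! hlt
  have hpos := (hv c (by simp)).one_le_leaves
  have hne := hlab (hc'.isInternal_iff.2 (by omega))
  have hxy := h a (a + leaves c'.2)
  rw [innerList_cons, innerList_cons, if_neg (by omega), if_pos le_rfl, if_pos ⟨rfl, rfl⟩] at hxy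
  have := innerList_support_of_valid (fun e he => hv e (List.mem_cons_of_mem _ he)) _ _ _
    (hxy.trans_ne hne)
  omega

theorem innerList_injective {cs cs' : List (M × STree M)}
    (hv : ∀ c ∈ cs, Valid c.2) (hlab : ∀ c ∈ cs, IsInternal c.2 → c.1 ≠ 1)
    (hv' : ∀ c ∈ cs', Valid c.2) (hlab' : ∀ c ∈ cs', IsInternal c.2 → c.1 ≠ 1)
    (ih : ∀ c ∈ cs, ∀ t' a, Valid t' → leaves c.2 = leaves t' →
      (∀ x y, inner c.2 a x y = inner t' a x y) → c.2 = t')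
    (a : ℕ) (hl : leavesList cs = leavesList cs')
    (h : ∀ x y, innerList cs a x y = innerList cs' a x y) : cs = cs' := by
  induction cs generalizing cs' a with
  | nil =>
    have := length_le_leavesList fun c hc => (hv' c hc).one_le_leaves
    rw [← hl, leavesList] at this
    exact (List.length_eq_zero_iff.1 (by omega)).symm
  | cons c cs ihl =>
    have hc := hv c (by simp)
    match cs' with
    | [] =>
      have := hc.one_le_leaves
      simp only [leavesList] at hl
      omega
    | c' :: cs' =>
      have hc' := hv' c' (by simp)
      have hvcs : ∀ d ∈ cs, Valid d.2 := fun d hd => hv d (by simp [hd])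
      have hvcs' : ∀ d ∈ cs', Valid d.2 := fun d hd => hv' d (by simp [hd])
      have heq : leaves c.2 = leaves c'.2 := le_antisymm
        (leaves_le_of_innerList_eq hv' hc (hlab c (by simp)) fun x y => (h x y).symm)
        (leaves_le_of_innerList_eq hv hc' (hlab' c' (by simp)) h)
      rw [leavesList_cons, leavesList_cons] at hl
      simp only [innerList_cons, ← heq] at h
      have hfst : c.1 = c'.1 := by simpa using h a (a + leaves c.2)
      have hsnd : c.2 = c'.2 := by
        refine ih c (by simp) c'.2 a hc' heq fun x y => ?_
        have hs := hc.inner_support a x y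
        have hs' := hc'.inner_support a x y
        have := h x y
        grind
      have htl : cs = cs' := by
        refine ihl hvcs (fun d hd => hlab d (by simp [hd])) hvcs'
          (fun d hd => hlab' d (by simp [hd])) (fun d hd => ih d (by simp [hd]))
          (a + leaves c.2) (by omega) fun x y => ?_
        have hs := innerList_support_of_valid hvcs (a + leaves c.2) x y
        have hs' := innerList_support_of_valid hvcs' (a + leaves c.2) x y
        have hxy := h x y
        by_cases hy : y ≤ a + leaves c.2
        · rw [not_ne_iff.1 fun h' => absurd (hs h') (by omega),
            not_ne_iff.1 fun h' => absurd (hs' h') (by omega)]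
        · rwa [if_neg hy, if_neg hy] at hxy
      rw [Prod.ext hfst hsnd, htl]

theorem Valid.inner_injective {t t' : STree M} (ht : Valid t) (a : ℕ) (ht' : Valid t')
    (hl : leaves t = leaves t') (h : ∀ x y, inner t a x y = inner t' a x y) : t = t' := by
  induction ht generalizing t' a with
  | leaf =>
    cases ht' with
    | leaf => rfl
    | node cs hlen hvalid hlab =>
      have := (Valid.node cs hlen hvalid hlab).two_le_leavesList
      simp only [leaves] at hl
      omega
  | node cs hlen hvalid hlab ih =>
    cases ht' with
    | leaf =>
      have := (Valid.node cs hlen hvalid hlab).two_le_leavesList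
      simp only [leaves] at hl
      omega
    | node cs' hlen' hvalid' hlab' =>
      simp only [leaves] at hl
      simp only [inner] at h
      rw [innerList_injective hvalid hlab hvalid' hlab'
        (fun c hc t' a ht' => ih c hc a ht') a hl h]

/-- The interval `[c, b]` of the polygon on `[a, b]` is cut along its maximal solid arcs, which
are encoded by trees. -/
theorem exists_innerList_eq {f : ℕ → ℕ → M} {a b : ℕ}
    (hf : ∀ x x' y y', a ≤ x → x < x' → x' < y → y < y' → y' ≤ b → f x y ≠ 1 → f x' y' = 1)
    (hab : a + 2 ≤ b)
    (ih : ∀ c d, a ≤ c → c < d → d ≤ b → d - c < b - a → ∃ t, Valid t ∧ leaves t = d - c ∧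
      ∀ x y, c ≤ x → x < y → y ≤ d → ¬(x = c ∧ y = d) → inner t c x y = f x y)
    (k c : ℕ) (hk : b - c = k) (hac : a ≤ c) (hcb : c ≤ b) :
    ∃ cs : List (M × STree M), (∀ e ∈ cs, Valid e.2) ∧ (∀ e ∈ cs, IsInternal e.2 → e.1 ≠ 1) ∧
      (∀ e ∈ cs, leaves e.2 < b - a) ∧ leavesList cs = b - c ∧
      ∀ x y, c ≤ x → x < y → y ≤ b → ¬(x = a ∧ y = b) → innerList cs c x y = f x y := by
  induction k using Nat.strong_induction_on generalizing c with
  | _ k ihk =>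
    classical
    rcases hcb.eq_or_lt with rfl | hcb
    · exact ⟨[], by simp, by simp, by simp, by simp [leavesList], by intros; omega⟩
    let P : ℕ → Prop := fun d => c < d ∧ ¬(c = a ∧ d = b) ∧ (d = c + 1 ∨ f c d ≠ 1)
    have hP : P (c + 1) := ⟨by omega, by omega, Or.inl rfl⟩
    obtain ⟨hcd, hne, hsolid⟩ : P (Nat.findGreatest P b) := Nat.findGreatest_spec hcb hP
    have hdb : Nat.findGreatest P b ≤ b := Nat.findGreatest_le b
    have hmax : ∀ y, Nat.findGreatest P b < y → y ≤ b → ¬P y :=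
      fun y => Nat.findGreatest_is_greatest
    generalize Nat.findGreatest P b = d at hcd hne hsolid hdb hmax
    obtain ⟨t, ht, htl, hti⟩ := ih c d hac hcd hdb (by omega)
    obtain ⟨cs, hv, hlab, hlt, hl, hi⟩ := ihk (b - d) (by omega) d rfl (by omega) hdb
    have hd : c + leaves t = d := by omega
    refine ⟨(f c d, t) :: cs, ?_, ?_, ?_, ?_, ?_⟩
    · simpa using ⟨ht, fun m s hs => hv (m, s) hs⟩
    · intro e he
      rcases List.mem_cons.1 he with rfl | he
      · intro hint
        have := ht.isInternal_iff.1 hint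
        exact hsolid.resolve_left (by omega)
      · exact hlab e he
    · intro e he
      rcases List.mem_cons.1 he with rfl | he
      · change leaves t < b - a
        omega
      · exact hlt e he
    · rw [leavesList_cons]
      change leaves t + _ = _
      omega
    · intro x y hcx hxy hyb hxyne
      rw [innerList_cons]
      simp only [hd]
      split_ifs with h₁ h₂
      · rw [h₂.1, h₂.2]
      · exact hti x y hcx hxy h₁ h₂
      · by_cases hx : d ≤ x
        · exact hi x y hx hxy hyb hxyne
        have hone : innerList cs d x y = 1 := by
          by_contra hc
          exact hx (innerList_support_of_valid hv d x y hc).1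
        rw [hone]
        symm
        rcases hcx.eq_or_lt with rfl | hcx
        · by_contra hfy
          exact hmax y (by omega) hyb ⟨hxy, hxyne, Or.inr hfy⟩
        · exact hf c x d y hac hcx (by omega) (by omega) hyb (hsolid.resolve_left (by omega))

theorem exists_inner_eq {f : ℕ → ℕ → M} (k a b : ℕ) (hk : b - a = k) (hab : a < b)
    (hf : ∀ x x' y y', a ≤ x → x < x' → x' < y → y < y' → y' ≤ b → f x y ≠ 1 → f x' y' = 1) :
    ∃ t, Valid t ∧ leaves t = b - a ∧
      ∀ x y, a ≤ x → x < y → y ≤ b → ¬(x = a ∧ y = b) → inner t a x y = f x y := by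
  induction k using Nat.strong_induction_on generalizing a b with
  | _ k ih =>
    by_cases hab' : b = a + 1
    · refine ⟨leaf, .leaf, ?_, ?_⟩
      · rw [leaves]
        omega
      · intros
        omega
    obtain ⟨cs, hv, hlab, hlt, hl, hi⟩ := exists_innerList_eq hf (by omega)
      (fun c d hac hcd hdb hlt => ih (d - c) (by omega) c d rfl hcd
        fun x x' y y' _ h₁ h₂ h₃ _ => hf x x' y y' (by omega) h₁ h₂ h₃ (by omega))
      (b - a) a rfl le_rfl hab.le
    refine ⟨node cs, .node cs ?_ hv hlab, by rw [leaves, hl], fun x y => by rw [inner]; exact hi x y⟩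
    match cs with
    | [] =>
      simp only [leavesList] at hl
      omega
    | [c] =>
      have := hlt c (by simp)
      simp only [leavesList] at hl
      omega
    | _ :: _ :: _ => simp

end STree

namespace MSchroder

variable {M : Type} [One M]

/-- The label of the arc `(x, y)` in the clique encoded by an `M`-Schröder tree. -/
def arcLabel : MSchroder M → ℕ → ℕ → M
  | single => fun _ _ => 1
  | rooted m cs _ => fun x y =>
      if x = 0 ∧ y = STree.leavesList cs then m else STree.inner (.node cs) 0 x y

theorem arcLabel_noncrossing (t : MSchroder M) {x x' y y' : ℕ} (h₁ : x < x') (h₂ : x' < y)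
    (h₃ : y < y') (hy' : y' ≤ t.leaves) (h : t.arcLabel x y ≠ 1) : t.arcLabel x' y' = 1 := by
  cases t with
  | single => rfl
  | rooted m cs hvalid =>
    simp only [leaves, STree.leaves] at hy'
    simp only [arcLabel] at h ⊢
    rw [if_neg (by omega)] at h ⊢
    exact hvalid.inner_noncrossing 0 x x' y y' h₁ h₂ h₃ h

theorem arcLabel_of_leaves_eq_one (t : MSchroder M) (h : t.leaves = 1) (x y : ℕ) :
    t.arcLabel x y = 1 := by
  cases t with
  | single => rfl
  | rooted m cs hvalid =>
    have := hvalid.two_le_leavesList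
    simp only [leaves, STree.leaves] at h
    omega

theorem arcLabel_injective {t t' : MSchroder M} (hl : t.leaves = t'.leaves)
    (h : ∀ x y, x < y → y ≤ t.leaves → t.arcLabel x y = t'.arcLabel x y) : t = t' := by
  cases t with
  | single =>
    cases t' with
    | single => rfl
    | rooted m cs hvalid =>
      have := hvalid.two_le_leavesList
      simp only [leaves, STree.leaves] at hl
      omega
  | rooted m cs hvalid =>
    have htwo := hvalid.two_le_leavesList
    cases t' with
    | single =>
      simp only [leaves, STree.leaves] at hl
      omega
    | rooted m' cs' hvalid' =>
      simp only [leaves] at hl h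
      have hl' := hl
      simp only [STree.leaves] at hl' h
      simp only [arcLabel, ← hl'] at h
      have hm : m = m' := by simpa using h 0 (STree.leavesList cs) (by omega) le_rfl
      have hcs : STree.node cs = .node cs' := by
        refine hvalid.inner_injective 0 hvalid' hl fun x y => ?_
        have hs := hvalid.inner_support 0 x y
        have hs' := hvalid'.inner_support 0 x y
        have := h x y
        simp only [STree.leaves] at hs hs'
        grind
      cases hcs
      rw [hm]

theorem exists_arcLabel_eq {f : ℕ → ℕ → M} {n : ℕ} (hn : 2 ≤ n)
    (hf : ∀ x x' y y', x < x' → x' < y → y < y' → y' ≤ n → f x y ≠ 1 → f x' y' = 1) :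
    ∃ t : MSchroder M, t.leaves = n ∧ ∀ x y, x < y → y ≤ n → t.arcLabel x y = f x y := by
  obtain ⟨t, ht, hl, hi⟩ := STree.exists_inner_eq (n - 0) 0 n rfl (by omega)
    (fun x x' y y' _ => hf x x' y y')
  cases t with
  | leaf =>
    simp only [STree.leaves] at hl
    omega
  | node cs =>
    refine ⟨rooted (f 0 n) cs ht, hl, fun x y hxy hy => ?_⟩
    simp only [STree.leaves, Nat.sub_zero] at hl
    simp only [arcLabel, hl]
    split_ifs with h
    · rw [h.1, h.2]
    · exact hi x y (by omega) hxy hy h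

/-- The noncrossing clique encoded by an `M`-Schröder tree. -/
def toNCClique {n : ℕ} (t : {t : MSchroder M // t.leaves = n}) : NCClique M n :=
  ⟨fun a => t.1.arcLabel a.1.1 a.1.2, by
    refine ⟨?_, fun hn a => t.1.arcLabel_of_leaves_eq_one (t.2.trans hn) _ _⟩
    rintro a b - - ha hb (⟨h₁, h₂, h₃⟩ | ⟨h₁, h₂, h₃⟩)
    · exact hb (t.1.arcLabel_noncrossing h₁ h₂ h₃ (by have := b.1.2.2; rw [t.2]; omega) ha)
    · exact ha (t.1.arcLabel_noncrossing h₁ h₂ h₃ (by have := a.1.2.2; rw [t.2]; omega) hb)⟩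

theorem toNCClique_injective (n : ℕ) : Function.Injective (toNCClique (M := M) (n := n)) := by
  rintro ⟨t, rfl⟩ ⟨t', ht'⟩ h
  refine Subtype.ext (arcLabel_injective ht'.symm fun x y hxy hy => ?_)
  change y ≤ t.leaves at hy
  exact congrFun (congrArg Subtype.val h)
    ⟨(⟨x, by omega⟩, ⟨y, by omega⟩), Fin.mk_lt_mk.2 hxy⟩

theorem toNCClique_surjective {n : ℕ} (hn : 1 ≤ n) :
    Function.Surjective (toNCClique (M := M) (n := n)) := by
  rintro ⟨p, hp, hone⟩
  rcases hn.eq_or_lt with rfl | hn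
  · exact ⟨⟨single, rfl⟩, Subtype.ext (funext fun a => (hone rfl a).symm)⟩
  let f : ℕ → ℕ → M := fun x y =>
    if h : x < y ∧ y ≤ n then p ⟨(⟨x, by omega⟩, ⟨y, by omega⟩), Fin.mk_lt_mk.2 h.1⟩ else 1
  obtain ⟨t, ht, hi⟩ := exists_arcLabel_eq (f := f) hn (by
    intro x x' y y' h₁ h₂ h₃ hy' h
    by_contra h'
    simp only [f] at h h'
    rw [dif_pos (by omega)] at h h'
    refine hp _ _ ?_ ?_ h h' (Or.inl ⟨h₁, h₂, h₃⟩) <;>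
      simp only [Arc.IsDiagonal, Arc.IsBase, Arc.IsEdge] <;> omega)
  refine ⟨⟨t, ht⟩, Subtype.ext (funext fun a => ?_)⟩
  have hlt : (a.1.1 : ℕ) < a.1.2 := a.2
  have hle : (a.1.2 : ℕ) ≤ n := by have := a.1.2.2; omega
  refine (hi _ _ hlt hle).trans ?_
  simp only [f]
  rw [dif_pos ⟨hlt, hle⟩]
  rfl

end MSchroder

/-- For every `n ≥ 1`, noncrossing `M`-cliques of arity `n` are in bijection with
`M`-Schröder trees having `n` leaves. -/
theorem statement2 (M : Type) [MulOneClass M] (n : ℕ) (hn : 1 ≤ n) :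
    Nonempty (NCClique M n ≃ {t : MSchroder M // t.leaves = n}) := by
  exact ⟨(Equiv.ofBijective _
    ⟨MSchroder.toNCClique_injective n, MSchroder.toNCClique_surjective hn⟩).symm⟩
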